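/- Let f : ℝᵈ → ℝ be convex and differentiable at every point, and suppose there are constants M, K ≥ 0 with |f(z)| ≤ M + K·‖z‖² for all z ∈ ℝᵈ. Then for every z ∈ ℝᵈ one has ‖∇f(z)‖ ≤ 2M + 5K·(‖z‖ + 1); in particular the gradient of f grows at most linearly. -/

import Mathlib

/-- The subdifferential inequality: a convex function lies above its tangent hyperplanes. -/
theorem ConvexOn.add_inner_gradient_le {E : Type*} [NormedAddCommGroup E]
    [InnerProductSpace ℝ E] [CompleteSpace E] {f : E → ℝ} (hconv : ConvexOn ℝ Set.univ f)
    {z : E} (hdiff : DifferentiableAt ℝ f z) (w : E) :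
    f z + inner ℝ (gradient f z) w ≤ f (z + w) := by
  have hline : ConvexOn ℝ Set.univ (fun t : ℝ => f (z + t • w)) := by
    have h := hconv.comp_affineMap (AffineMap.lineMap z (z + w))
    simpa [Function.comp_def, AffineMap.lineMap_apply, add_comm] using h
  have hderiv : HasDerivAt (fun t : ℝ => f (z + t • w)) (inner ℝ (gradient f z) w) 0 := by
    have h := hdiff.hasGradientAt.hasFDerivAt.hasLineDerivAt w
    simpa [HasLineDerivAt] using h
  have h := hline.le_slope_of_hasDerivAt (Set.mem_univ 0) (Set.mem_univ 1) one_pos hderiv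
  simp only [slope_def_field, one_smul, zero_smul, add_zero, sub_zero, div_one] at h
  linarith

/-- A convex, everywhere differentiable function `f : ℝᵈ → ℝ` with quadratic growth
`|f(z)| ≤ M + K‖z‖²` has a gradient of at most linear growth:
`‖∇f(z)‖ ≤ 2M + 5K(‖z‖ + 1)` for every `z`. -/
theorem gradient_linear_growth_of_convex_quadratic_growth
    (d : ℕ) (hd : 1 ≤ d)
    (f : EuclideanSpace ℝ (Fin d) → ℝ)
    (hconv : ConvexOn ℝ Set.univ f)
    (hdiff : Differentiable ℝ f)
    (M K : ℝ) (hM : 0 ≤ M) (hK : 0 ≤ K)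
    (hbound : ∀ z : EuclideanSpace ℝ (Fin d), |f z| ≤ M + K * ‖z‖ ^ 2) :
    ∀ z : EuclideanSpace ℝ (Fin d),
      ‖gradient f z‖ ≤ 2 * M + 5 * K * (‖z‖ + 1) := by
  intro z
  by_cases hg : gradient f z = 0
  · rw [hg, norm_zero]
    positivity
  have hgpos : 0 < ‖gradient f z‖ := norm_pos_iff.mpr hg
  have hz : 0 ≤ ‖z‖ := norm_nonneg z
  set w := ((‖z‖ + 1) / ‖gradient f z‖) • gradient f z with hw
  have hnorm : ‖w‖ = ‖z‖ + 1 := by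
    rw [hw, norm_smul, Real.norm_of_nonneg (by positivity), div_mul_cancel₀ _ hgpos.ne']
  have hinner : inner ℝ (gradient f z) w = (‖z‖ + 1) * ‖gradient f z‖ := by
    rw [hw, real_inner_smul_right, real_inner_self_eq_norm_sq]
    field_simp
  have htangent := hconv.add_inner_gradient_le (hdiff z) w
  rw [hinner] at htangent
  have hupper := (le_abs_self _).trans (hbound (z + w))
  have hlower := (neg_le_abs _).trans (hbound z)
  have hsq : ‖z + w‖ ^ 2 ≤ (2 * ‖z‖ + 1) ^ 2 := by
    gcongr
    linarith [norm_add_le z w]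
  have hKsq := mul_le_mul_of_nonneg_left hsq hK
  refine le_of_mul_le_mul_left ?_ (show 0 < ‖z‖ + 1 by positivity)
  nlinarith [mul_nonneg hM hz, mul_nonneg hK hz, mul_nonneg hK (sq_nonneg ‖z‖)]
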